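/- There is no covariant fully faithful functor from the category of Giry algebras (Eilenberg–Moore algebras over the Giry monad on measurable spaces) to the category of convex spaces with affine maps. That is, there is no assignment F sending each Giry algebra (X,κ) to a convex space F(X,κ) and each morphism of Giry algebras u : (X,κ) → (Y,λ) to an affine map F(u) : F(X,κ) → F(Y,λ), preserving identities and composition, such that for every pair of Giry algebras the induced map on hom-sets u ↦ F(u) is both injective (faithful) and surjective (full). -/

import Mathlib

namespace Paper

/-- A family of convex combination operations satisfies the axioms of a convex space:
unit law, idempotency, parametric commutativity and deformed parametric associativity. -/
structure IsConvexStruct {A : Type*} (comb : unitInterval → A → A → A) : Prop where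
  unit : ∀ x y, comb 0 x y = x
  idem : ∀ r x, comb r x x = x
  comm : ∀ r x y, comb r x y = comb (unitInterval.symm r) y x
  assoc : ∀ (r s t u : unitInterval), 0 < (s : ℝ) → (t : ℝ) = r + s - r * s →
    (u : ℝ) = (s : ℝ) / (t : ℝ) →
    ∀ x y z, comb s (comb r x y) z = comb t x (comb u y z)

section GiryMonad

open MeasureTheory

/-- The evaluation σ-algebra on the space `G(X)` of probability measures on `X`:
the σ-algebra induced from the σ-algebra on measures generated by the evaluations
`φ ↦ φ K` for `K` measurable. -/
noncomputable instance {X : Type*} [MeasurableSpace X] :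
    MeasurableSpace (ProbabilityMeasure X) :=
  MeasurableSpace.comap ProbabilityMeasure.toMeasure inferInstance

lemma measurable_toMeasure {X : Type*} [MeasurableSpace X] :
    Measurable (ProbabilityMeasure.toMeasure : ProbabilityMeasure X → Measure X) :=
  Measurable.of_comap_le le_rfl

/-- The Dirac measure as a probability measure: the unit of the Giry monad. -/
noncomputable def dirac {X : Type*} [MeasurableSpace X] (x : X) : ProbabilityMeasure X :=
  ⟨Measure.dirac x, inferInstance⟩

/-- Pushforward of a probability measure along a measurable map (the action of the
Giry functor on morphisms): `G(f)(φ) = φ ∘ f⁻¹`. -/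
noncomputable def pushforward {X Y : Type*} [MeasurableSpace X] [MeasurableSpace Y]
    (f : X → Y) (hf : Measurable f) (φ : ProbabilityMeasure X) : ProbabilityMeasure Y :=
  ⟨φ.toMeasure.map f, by
    constructor
    rw [Measure.map_apply hf MeasurableSet.univ]
    simp⟩

/-- The multiplication `μ_X : G(G(X)) → G(X)` of the Giry monad,
`μ_X(Φ)(K) = ∫ ξ(K) dΦ(ξ)`. -/
noncomputable def join {X : Type*} [MeasurableSpace X]
    (Φ : ProbabilityMeasure (ProbabilityMeasure X)) : ProbabilityMeasure X :=
  ⟨(Φ.toMeasure.map ProbabilityMeasure.toMeasure).join, by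
    constructor
    rw [Measure.join_apply MeasurableSet.univ,
      lintegral_map (Measure.measurable_coe MeasurableSet.univ) measurable_toMeasure]
    simp⟩

/-- The convex combination `φ +ᵣ ψ = (1-r)·φ + r·ψ` of two probability measures. -/
noncomputable def pcomb {X : Type*} [MeasurableSpace X] (r : unitInterval)
    (φ ψ : ProbabilityMeasure X) : ProbabilityMeasure X :=
  ⟨ENNReal.ofReal (1 - (r : ℝ)) • φ.toMeasure + ENNReal.ofReal (r : ℝ) • ψ.toMeasure, by
    constructor
    simp only [Measure.coe_add, Measure.coe_smul, Pi.add_apply, Pi.smul_apply,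
      measure_univ, smul_eq_mul, mul_one]
    rw [← ENNReal.ofReal_add (by linarith [r.2.2]) r.2.1]
    norm_num⟩

lemma integral_mem_unitInterval {X : Type*} [MeasurableSpace X] (φ : ProbabilityMeasure X)
    (f : X → ℝ) (h0 : ∀ x, 0 ≤ f x) (h1 : ∀ x, f x ≤ 1) :
    ∫ x, f x ∂φ.toMeasure ∈ unitInterval := by
  refine ⟨integral_nonneg h0, ?_⟩
  have h := integral_mono_of_nonneg (μ := φ.toMeasure) (f := f) (g := fun _ => (1 : ℝ))
    (Filter.Eventually.of_forall h0) (integrable_const 1) (Filter.Eventually.of_forall h1)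
  simpa using h

/-- The structure map `E : G(I) → I`, `E(ω) = ∫ x dω`, of the Giry algebra `(I, E)`. -/
noncomputable def Eop (ω : ProbabilityMeasure unitInterval) : unitInterval :=
  ⟨∫ x, (x : ℝ) ∂ω.toMeasure,
    integral_mem_unitInterval ω _ (fun x => x.2.1) (fun x => x.2.2)⟩

/-- The structure map `E_M : G(I^M) → I^M`, `E_M(φ)(m) = ∫ ev_m dφ`. -/
noncomputable def EM (M : Type*) (φ : ProbabilityMeasure (M → unitInterval)) :
    M → unitInterval :=
  fun m => ⟨∫ α, (α m : ℝ) ∂φ.toMeasure,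
    integral_mem_unitInterval φ _ (fun α => (α m).2.1) (fun α => (α m).2.2)⟩

end GiryMonad

open CategoryTheory

/-- An Eilenberg–Moore algebra over the Giry monad: a measurable space `carrier`
together with a measurable structure map `str : G(carrier) → carrier` satisfying
`str(δ_x) = x` and `str ∘ G(str) = str ∘ μ`. -/
structure GiryAlg : Type 1 where
  carrier : Type
  [meas : MeasurableSpace carrier]
  str : MeasureTheory.ProbabilityMeasure carrier → carrier
  measurable_str : Measurable str
  str_dirac : ∀ x, str (dirac x) = x
  str_join : ∀ Φ : MeasureTheory.ProbabilityMeasure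
      (MeasureTheory.ProbabilityMeasure carrier),
    str (pushforward str measurable_str Φ) = str (join Φ)

attribute [instance] GiryAlg.meas

/-- Morphisms of Giry algebras: measurable maps commuting with the structure maps,
`f ∘ κ = λ ∘ G(f)`. -/
def GiryHom (A B : GiryAlg) : Type :=
  {f : A.carrier → B.carrier //
    ∃ hf : Measurable f, ∀ φ, f (A.str φ) = B.str (pushforward f hf φ)}

section PushforwardLemmas

open MeasureTheory

lemma pushforward_id {X : Type*} [MeasurableSpace X] (φ : ProbabilityMeasure X) :
    pushforward id measurable_id φ = φ := by
  apply Subtype.ext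
  simp [pushforward]

lemma pushforward_comp {X Y Z : Type*} [MeasurableSpace X] [MeasurableSpace Y]
    [MeasurableSpace Z] {f : X → Y} {g : Y → Z} (hf : Measurable f) (hg : Measurable g)
    (φ : ProbabilityMeasure X) :
    pushforward (g ∘ f) (hg.comp hf) φ = pushforward g hg (pushforward f hf φ) := by
  apply Subtype.ext
  simp [pushforward, Measure.map_map hg hf]

end PushforwardLemmas

/-- The category of Giry algebras. -/
noncomputable instance : Category GiryAlg where
  Hom := GiryHom
  id A := ⟨id, measurable_id, fun φ => by rw [pushforward_id]; rfl⟩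
  comp {A B C} f g := ⟨g.1 ∘ f.1, by
    obtain ⟨hf, hf'⟩ := f.2
    obtain ⟨hg, hg'⟩ := g.2
    exact ⟨hg.comp hf, fun φ => by
      simp only [Function.comp_apply, hf', hg', pushforward_comp hf hg]⟩⟩
  id_comp f := rfl
  comp_id f := rfl
  assoc f g h := rfl

/-- A convex space: a set with convex combination operations satisfying the axioms. -/
structure CvxCat : Type 1 where
  carrier : Type
  comb : unitInterval → carrier → carrier → carrier
  is_convex : IsConvexStruct comb

/-- The category of convex spaces with affine maps. -/
noncomputable instance : Category CvxCat where
  Hom A B := {f : A.carrier → B.carrier //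
    ∀ (r : unitInterval) (x y : A.carrier), f (A.comb r x y) = B.comb r (f x) (f y)}
  id A := ⟨id, fun _ _ _ => rfl⟩
  comp {A B C} f g := ⟨g.1 ∘ f.1, fun r x y => by
    simp only [Function.comp_apply, f.2, g.2]⟩
  id_comp f := rfl
  comp_id f := rfl
  assoc f g h := rfl

section EssSupAlgebra

open MeasureTheory Set
open scoped ENNReal

/-- The essential supremum of the identity, as a map `G([0,∞]) → [0,∞]`. -/
noncomputable def essSupId (φ : ProbabilityMeasure ℝ≥0∞) : ℝ≥0∞ :=
  essSup id φ.toMeasure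

lemma essSupId_le_iff (φ : ProbabilityMeasure ℝ≥0∞) (a : ℝ≥0∞) :
    essSupId φ ≤ a ↔ φ.toMeasure (Ioi a) = 0 := by
  have h : φ.toMeasure (Ioi a) = 0 ↔ ∀ᵐ x ∂φ.toMeasure, id x ≤ a := by
    rw [ae_iff]
    simp [Ioi]
  rw [h]
  exact ⟨fun h' => (ae_le_essSup (f := id)).mono fun x hx => hx.trans h',
    fun h' => essSup_le_of_ae_le a h'⟩

lemma measurable_eval {X : Type*} [MeasurableSpace X] {K : Set X} (hK : MeasurableSet K) :
    Measurable fun φ : ProbabilityMeasure X => φ.toMeasure K :=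
  (Measure.measurable_coe hK).comp measurable_toMeasure

lemma measurable_essSupId : Measurable essSupId := by
  refine measurable_of_Iic fun a => ?_
  have h : essSupId ⁻¹' Iic a = (fun φ : ProbabilityMeasure ℝ≥0∞ => φ.toMeasure (Ioi a)) ⁻¹' {0} := by
    ext φ
    simp [essSupId_le_iff]
  rw [h]
  exact measurable_eval measurableSet_Ioi (measurableSet_singleton 0)

lemma essSupId_pushforward_le_iff {X : Type*} [MeasurableSpace X] {f : X → ℝ≥0∞}
    (hf : Measurable f) (φ : ProbabilityMeasure X) (a : ℝ≥0∞) :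
    essSupId (pushforward f hf φ) ≤ a ↔ φ.toMeasure (f ⁻¹' Ioi a) = 0 := by
  rw [essSupId_le_iff, ← Measure.map_apply hf measurableSet_Ioi]
  rfl

lemma join_apply_eq_lintegral {X : Type*} [MeasurableSpace X]
    (Φ : ProbabilityMeasure (ProbabilityMeasure X)) {K : Set X} (hK : MeasurableSet K) :
    (join Φ).toMeasure K = ∫⁻ φ, φ.toMeasure K ∂Φ.toMeasure := by
  change (Φ.toMeasure.map ProbabilityMeasure.toMeasure).join K = _
  rw [Measure.join_apply hK, lintegral_map (Measure.measurable_coe hK) measurable_toMeasure]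

/-- The Giry algebra `[0,∞]` whose structure map is the essential supremum. -/
noncomputable def essSupAlg : GiryAlg where
  carrier := ℝ≥0∞
  str := essSupId
  measurable_str := measurable_essSupId
  str_dirac x := by
    refine eq_of_forall_ge_iff fun a => ?_
    rw [essSupId_le_iff]
    change Measure.dirac x (Ioi a) = 0 ↔ _
    simp [Measure.dirac_apply' x measurableSet_Ioi]
  str_join Φ := by
    refine eq_of_forall_ge_iff fun a => ?_
    rw [essSupId_pushforward_le_iff, essSupId_le_iff,
      join_apply_eq_lintegral Φ measurableSet_Ioi,
      lintegral_eq_zero_iff (measurable_eval measurableSet_Ioi), Filter.EventuallyEq, ae_iff]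
    simp only [Pi.zero_apply, ← essSupId_le_iff, not_le]
    rfl

/-- The one-point Giry algebra. -/
noncomputable def pointAlg : GiryAlg where
  carrier := PUnit
  str _ := PUnit.unit
  measurable_str := measurable_const
  str_dirac _ := rfl
  str_join _ := rfl

/-- The morphism from the one-point algebra picking out a point. -/
noncomputable def pointHom (A : GiryAlg) (x : A.carrier) : pointAlg ⟶ A :=
  ⟨fun _ => x, measurable_const, fun φ => by
    have h : pushforward (fun _ : pointAlg.carrier => x) measurable_const φ = dirac x := by
      apply Subtype.ext
      change Measure.map (fun _ => x) φ.toMeasure = Measure.dirac x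
      simp [Measure.map_const]
    rw [h, A.str_dirac]⟩

/-- The map sending `0` to `x` and everything else to `y`. -/
noncomputable def zeroSplit (x y t : ℝ≥0∞) : ℝ≥0∞ := if t = 0 then x else y

lemma measurable_zeroSplit (x y : ℝ≥0∞) : Measurable (zeroSplit x y) :=
  Measurable.ite (measurableSet_singleton 0) measurable_const measurable_const

lemma zeroSplit_essSupId {x y : ℝ≥0∞} (hxy : x ≤ y) (φ : ProbabilityMeasure ℝ≥0∞) :
    zeroSplit x y (essSupId φ) = essSupId (pushforward _ (measurable_zeroSplit x y) φ) := by
  refine eq_of_forall_ge_iff fun a => ?_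
  rw [essSupId_pushforward_le_iff]
  by_cases hy : y ≤ a
  · have h : zeroSplit x y ⁻¹' Ioi a = ∅ := by
      ext t
      simp only [zeroSplit, mem_preimage, mem_Ioi, mem_empty_iff_false, iff_false, not_lt]
      split_ifs
      exacts [hxy.trans hy, hy]
    rw [h]
    simp only [measure_empty, iff_true, zeroSplit]
    split_ifs
    exacts [hxy.trans hy, hy]
  · by_cases hx : x ≤ a
    · have h : zeroSplit x y ⁻¹' Ioi a = Ioi 0 := by
        ext t
        by_cases ht : t = 0
        · simp [zeroSplit, ht, hx]
        · simpa [zeroSplit, ht, pos_iff_ne_zero] using hy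
      rw [h, ← essSupId_le_iff, nonpos_iff_eq_zero]
      by_cases ht : essSupId φ = 0
      · simp [zeroSplit, ht, hx]
      · simp [zeroSplit, ht, hy]
    · have h : zeroSplit x y ⁻¹' Ioi a = univ := by
        ext t
        by_cases ht : t = 0
        · simpa [zeroSplit, ht] using hx
        · simpa [zeroSplit, ht] using hy
      rw [h]
      simp only [measure_univ, one_ne_zero, iff_false, zeroSplit]
      split_ifs
      exacts [hx, hy]

/-- `zeroSplit x y` as an endomorphism of the essential supremum algebra, for `x ≤ y`. -/
noncomputable def zeroSplitHom {x y : ℝ≥0∞} (hxy : x ≤ y) : essSupAlg ⟶ essSupAlg :=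
  ⟨zeroSplit x y, measurable_zeroSplit x y, zeroSplit_essSupId hxy⟩

/-- The indicator function of `[1,∞]`, which preserves binary but not countable suprema. -/
noncomputable def oneStep (t : ℝ≥0∞) : ℝ≥0∞ := if 1 ≤ t then 1 else 0

lemma oneStep_mono : Monotone oneStep := by
  intro s t hst
  unfold oneStep
  split_ifs with hs ht
  exacts [le_rfl, absurd (hs.trans hst) ht, zero_le_one, le_rfl]

lemma oneStep_zeroSplit (x y t : ℝ≥0∞) :
    oneStep (zeroSplit x y t) = zeroSplit (oneStep x) (oneStep y) t :=
  apply_ite oneStep _ _ _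

lemma oneStep_not_hom (hf : Measurable oneStep) :
    ∃ φ, oneStep (essSupId φ) ≠ essSupId (pushforward oneStep hf φ) := by
  have hm : Measurable fun t : unitInterval => ENNReal.ofReal (t : ℝ) :=
    ENNReal.measurable_ofReal.comp measurable_subtype_coe
  refine ⟨pushforward _ hm ⟨volume, inferInstance⟩, ?_⟩
  have h1 : 1 ≤ essSupId (pushforward _ hm ⟨volume, inferInstance⟩) := by
    by_contra! hlt
    obtain ⟨a, ha, ha1⟩ := exists_between hlt
    have h := (essSupId_pushforward_le_iff hm _ a).1 ha.le
    change (volume : Measure unitInterval) _ = 0 at h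
    have hpre : (fun t : unitInterval => ENNReal.ofReal (t : ℝ)) ⁻¹' Ioi a =
        Ioi (⟨a.toReal, ENNReal.toReal_nonneg,
          ENNReal.toReal_le_of_le_ofReal zero_le_one (by simpa using ha1.le)⟩ : unitInterval) := by
      ext t
      simp [ENNReal.lt_ofReal_iff_toReal_lt (ha1.trans ENNReal.one_lt_top).ne, ← Subtype.coe_lt_coe]
    rw [hpre, unitInterval.volume_Ioi, ENNReal.ofReal_eq_zero, sub_nonpos] at h
    exact absurd h (not_le.2 ((ENNReal.toReal_lt_toReal (ha1.trans ENNReal.one_lt_top).ne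
      ENNReal.one_ne_top).2 ha1))
  have h2 : essSupId (pushforward oneStep hf (pushforward _ hm ⟨volume, inferInstance⟩)) ≤ 0 := by
    rw [essSupId_pushforward_le_iff]
    change Measure.map _ (volume : Measure unitInterval) _ = 0
    rw [Measure.map_apply hm (hf measurableSet_Ioi)]
    refine measure_mono_null (t := {1}) ?_ (by simp)
    intro t ht
    by_contra hne
    have hlt : (t : ℝ) < 1 := lt_of_le_of_ne t.2.2 fun h => hne (Subtype.ext h)
    simp [oneStep, not_le.2 hlt] at ht
  intro h
  rw [nonpos_iff_eq_zero.1 h2] at h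
  simp [oneStep, h1] at h

end EssSupAlgebra

section FullyFaithful

variable (F : GiryAlg ⥤ CvxCat)

/-- Constant maps between convex spaces are affine. -/
def CvxCat.constHom (A B : CvxCat) (z : B.carrier) : A ⟶ B :=
  ⟨fun _ => z, fun r _ _ => (B.is_convex.idem r z).symm⟩

lemma subsingleton_obj_pointAlg [F.Full] : Subsingleton (F.obj pointAlg).carrier := by
  have h : ∀ g : F.obj pointAlg ⟶ F.obj pointAlg, g = 𝟙 _ := fun g => by
    obtain ⟨u, rfl⟩ := F.map_surjective g
    have hu : u = 𝟙 pointAlg := rfl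
    rw [hu, F.map_id]
  refine ⟨fun z w => ?_⟩
  have hz := congrArg (fun g => g.1 w) (h (CvxCat.constHom _ _ z))
  exact hz

lemma nonempty_obj_pointAlg [F.Faithful] : Nonempty (F.obj pointAlg).carrier := by
  by_contra hne
  rw [not_nonempty_iff] at hne
  have h : pointHom essSupAlg (0 : ENNReal) = pointHom essSupAlg (1 : ENNReal) :=
    F.map_injective (Subtype.ext (funext fun z => hne.elim z))
  exact zero_ne_one (α := ENNReal) (congrArg (fun g => g.1 PUnit.unit) h)

/-- The point of `F A` corresponding to a point of `A`, given a base point of `F 1`. -/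
noncomputable def pointMap (b : (F.obj pointAlg).carrier) (A : GiryAlg) (x : A.carrier) :
    (F.obj A).carrier :=
  (F.map (pointHom A x)).1 b

lemma map_pointMap (b : (F.obj pointAlg).carrier) {A B : GiryAlg} (u : A ⟶ B)
    (x : A.carrier) : (F.map u).1 (pointMap F b A x) = pointMap F b B (u.1 x) := by
  have h : pointHom A x ≫ u = pointHom B (u.1 x) := rfl
  unfold pointMap
  rw [← h, F.map_comp]
  rfl

lemma pointMap_bijective [F.Full] [F.Faithful] (b : (F.obj pointAlg).carrier) (A : GiryAlg) :
    Function.Bijective (pointMap F b A) := by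
  have := subsingleton_obj_pointAlg F
  constructor
  · intro x y hxy
    have h : pointHom A x = pointHom A y := by
      refine F.map_injective (Subtype.ext (funext fun z => ?_))
      rw [Subsingleton.elim z b]
      exact hxy
    exact congrArg (fun g => g.1 PUnit.unit) h
  · intro z
    obtain ⟨u, hu⟩ := F.map_surjective (CvxCat.constHom (F.obj pointAlg) (F.obj A) z)
    refine ⟨u.1 PUnit.unit, ?_⟩
    have h : pointHom A (u.1 PUnit.unit) = u := rfl
    unfold pointMap
    rw [h, hu]
    rfl

/-- A self-map of `A` that is affine for the convex structure transported from `F A` is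
a morphism of Giry algebras. -/
lemma exists_hom_of_affine [F.Full] [F.Faithful] (b : (F.obj pointAlg).carrier) {A : GiryAlg}
    (e : A.carrier ≃ (F.obj A).carrier) (he : ∀ x, e x = pointMap F b A x)
    (f : A.carrier → A.carrier)
    (hf : ∀ r x y, f (e.symm ((F.obj A).comb r (e x) (e y))) =
      e.symm ((F.obj A).comb r (e (f x)) (e (f y)))) :
    ∃ u : A ⟶ A, u.1 = f := by
  obtain ⟨u, hu⟩ := F.map_surjective (X := A) (Y := A) ⟨fun z => e (f (e.symm z)), fun r z w => by
    simpa using congrArg e (hf r (e.symm z) (e.symm w))⟩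
  refine ⟨u, funext fun x => e.injective ?_⟩
  rw [he (u.1 x), ← map_pointMap, ← he, hu]
  simp

lemma symm_comb_eq_zeroSplit (b : (F.obj pointAlg).carrier)
    (e : ENNReal ≃ (F.obj essSupAlg).carrier) (he : ∀ x, e x = pointMap F b essSupAlg x)
    (r : unitInterval) {x y : ENNReal} (hxy : x ≤ y) :
    e.symm ((F.obj essSupAlg).comb r (e x) (e y)) =
      zeroSplit x y (e.symm ((F.obj essSupAlg).comb r (e 0) (e 1))) := by
  have key : ∀ t, (F.map (zeroSplitHom hxy)).1 (e t) = e (zeroSplit x y t) := fun t => by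
    rw [he, he]
    exact map_pointMap F b (zeroSplitHom hxy) t
  have h := (F.map (zeroSplitHom hxy)).2 r (e 0) (e 1)
  rw [key, key, ← e.apply_symm_apply ((F.obj essSupAlg).comb r (e 0) (e 1)), key] at h
  rw [e.symm_apply_eq, h]
  simp [zeroSplit]

end FullyFaithful

/-- **Theorem (statement 0).** There is no covariant fully faithful functor from the
category of Giry algebras to the category of convex spaces. -/
theorem no_fully_faithful_functor_from_GiryAlg_to_CvxCat :
    ¬ ∃ F : GiryAlg ⥤ CvxCat, F.Full ∧ F.Faithful := by
  rintro ⟨F, _, _⟩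
  obtain ⟨b⟩ := nonempty_obj_pointAlg F
  let e : ENNReal ≃ (F.obj essSupAlg).carrier :=
    Equiv.ofBijective _ (pointMap_bijective F b essSupAlg)
  have he : ∀ x, e x = pointMap F b essSupAlg x := fun _ => rfl
  have affine_of_le : ∀ r (x y : ENNReal), x ≤ y →
      oneStep (e.symm ((F.obj essSupAlg).comb r (e x) (e y))) =
        e.symm ((F.obj essSupAlg).comb r (e (oneStep x)) (e (oneStep y))) := fun r x y hxy => by
    rw [symm_comb_eq_zeroSplit F b e he r hxy,
      symm_comb_eq_zeroSplit F b e he r (oneStep_mono hxy), oneStep_zeroSplit]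
  have affine : ∀ r (x y : ENNReal),
      oneStep (e.symm ((F.obj essSupAlg).comb r (e x) (e y))) =
        e.symm ((F.obj essSupAlg).comb r (e (oneStep x)) (e (oneStep y))) := fun r x y => by
    rcases le_total x y with hxy | hxy
    · exact affine_of_le r x y hxy
    · rw [(F.obj essSupAlg).is_convex.comm r (e x),
        (F.obj essSupAlg).is_convex.comm r (e (oneStep x))]
      exact affine_of_le _ y x hxy
  obtain ⟨u, hu⟩ := exists_hom_of_affine F b (A := essSupAlg) e he oneStep affine
  obtain ⟨hm, hstr⟩ := u.2
  simp only [hu] at hm hstr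
  obtain ⟨φ, hφ⟩ := oneStep_not_hom hm
  exact hφ (hstr φ)

end Paper
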